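/- arXiv:1610.03428 — 4 statements merged into one kernel-verified Lean document; each statement's English description precedes it below -/
import Mathlib

section
/- For every prime p ≥ 3 there exist ε(p), δ(p) ∈ (0,∞) such that the following holds. For every integer n ≥ p² and every nonempty set D ⊆ 𝔽_p^n: if |D| < δ(p)·n^{p−1}, then ‖A_{L_D} − A_{L_{𝔽_p^n}}‖_{ℓ_p,…,ℓ_p} ≥ ε(p). -/
/-- Evaluation of a `t`-linear form on `ℝ^V`, given by its coefficient tensor `A`. -/
noncomputable def evalForm {V : Type*} [Fintype V] {t : ℕ}
    (A : (Fin t → V) → ℝ) (x : Fin t → V → ℝ) : ℝ :=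
  ∑ z : Fin t → V, A z * ∏ j, x j (z j)

/-- The `ℓ_p` norm of a vector in `ℝ^V`. -/
noncomputable def lpNorm {V : Type*} [Fintype V] (p : ℝ) (x : V → ℝ) : ℝ :=
  (∑ v, |x v| ^ p) ^ (1/p)

/-- The `ℓ_p,…,ℓ_p` norm of a `t`-linear form on `ℝ^V`:
`sup { |A(x₁,…,x_t)| / (‖x₁‖_p ⋯ ‖x_t‖_p) : xⱼ ≠ 0 }`. -/
noncomputable def formNorm {V : Type*} [Fintype V] {t : ℕ} (p : ℝ)
    (A : (Fin t → V) → ℝ) : ℝ :=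
  sSup {c | ∃ x : Fin t → V → ℝ, (∀ j, x j ≠ 0) ∧
    c = |evalForm A x| / ∏ j, lpNorm p (x j)}

/-- The normalized adjacency form `A_{L_D}` of the `p`-uniform Cayley hypergraph of lines
with directions in `D ⊆ 𝔽_p^n`, given as its coefficient tensor:
`A_{L_D}(1_{z₁},…,1_{z_p}) = (1/(|D| p!)) Σ_{y∈D} Σ_x Σ_σ Π_j 1[z_j = x + (σ(j)−1) y]`
(identifying `[p] = {1,…,p}` with `{0,…,p−1}` via `σ(j) − 1 = (σ j).val`). -/
noncomputable def lineForm (p n : ℕ) [NeZero p] (D : Finset (Fin n → ZMod p)) :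
    (Fin p → (Fin n → ZMod p)) → ℝ :=
  fun z => (1 / (D.card * Nat.factorial p : ℝ)) *
    ∑ y ∈ D, ∑ x : Fin n → ZMod p, ∑ σ : Equiv.Perm (Fin p),
      ∏ j, if z j = x + ((σ j).val : ZMod p) • y then (1:ℝ) else 0

open Finset

/-! ### Bounding the form norm from below -/

lemma abs_le_lpNorm {V : Type*} [Fintype V] {p : ℝ} (hp : 0 < p) (x : V → ℝ) (v : V) :
    |x v| ≤ lpNorm p x := by
  have h : |x v| ^ p ≤ ∑ w, |x w| ^ p :=
    single_le_sum (f := fun w => |x w| ^ p) (fun w _ => by positivity) (mem_univ v)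
  calc |x v| = (|x v| ^ p) ^ (1 / p) := by
        rw [← Real.rpow_mul (abs_nonneg _), mul_one_div_cancel hp.ne', Real.rpow_one]
    _ ≤ lpNorm p x := Real.rpow_le_rpow (by positivity) h (by positivity)

lemma lpNorm_nonneg {V : Type*} [Fintype V] (p : ℝ) (x : V → ℝ) : 0 ≤ lpNorm p x := by
  unfold lpNorm
  positivity

lemma div_le_formNorm {V : Type*} [Fintype V] {t : ℕ} {p : ℝ} (hp : 0 < p)
    (A : (Fin t → V) → ℝ) (x : Fin t → V → ℝ) (hx : ∀ j, x j ≠ 0) :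
    |evalForm A x| / ∏ j, lpNorm p (x j) ≤ formNorm p A := by
  refine le_csSup ⟨∑ z, |A z|, ?_⟩ ⟨x, hx, rfl⟩
  rintro _ ⟨y, -, rfl⟩
  refine div_le_of_le_mul₀ (prod_nonneg fun j _ => lpNorm_nonneg p (y j))
    (sum_nonneg fun z _ => abs_nonneg _) ?_
  rw [evalForm, sum_mul]
  refine (abs_sum_le_sum_abs _ _).trans (sum_le_sum fun z _ => ?_)
  rw [abs_mul, abs_prod]
  gcongr with j
  exact abs_le_lpNorm hp (y j) (z j)

lemma evalForm_sub {V : Type*} [Fintype V] {t : ℕ} (A B : (Fin t → V) → ℝ)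
    (x : Fin t → V → ℝ) :
    evalForm (fun z => A z - B z) x = evalForm A x - evalForm B x := by
  simp [evalForm, sub_mul]

lemma evalForm_eq_zero_of_eq_zero {V : Type*} [Fintype V] {t : ℕ} (A : (Fin t → V) → ℝ)
    (x : Fin t → V → ℝ) {j : Fin t} (hj : x j = 0) : evalForm A x = 0 :=
  sum_eq_zero fun z _ => by
    rw [prod_eq_zero (mem_univ j) (by simp [hj]), mul_zero]

/-- The indicator of a level set, as a real vector. -/
noncomputable def levelIndicator {V K : Type*} [DecidableEq K] (Q : V → K) (a : K) : V → ℝ :=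
  fun v => if Q v = a then 1 else 0

lemma lpNorm_levelIndicator_le {V K : Type*} [Fintype V] [DecidableEq K] {p : ℝ} (hp : 0 < p)
    (Q : V → K) (a : K) : lpNorm p (levelIndicator Q a) ≤ (Fintype.card V : ℝ) ^ (1 / p) := by
  refine Real.rpow_le_rpow (sum_nonneg fun v _ => by positivity) ?_ (by positivity)
  calc ∑ v, |levelIndicator Q a v| ^ p ≤ ∑ _v : V, (1 : ℝ) := by
        refine sum_le_sum fun v _ => ?_
        unfold levelIndicator
        split_ifs <;> simp [hp.ne']
    _ = Fintype.card V := by simp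

lemma prod_lpNorm_levelIndicator_le {V K : Type*} [Fintype V] [DecidableEq K] {p : ℕ}
    (hp : 0 < p) (Q : V → K) (a : Fin p → K) :
    ∏ j, lpNorm (p : ℝ) (levelIndicator Q (a j)) ≤ Fintype.card V := by
  have hp' : (0 : ℝ) < p := by exact_mod_cast hp
  calc ∏ j, lpNorm (p : ℝ) (levelIndicator Q (a j))
      ≤ ∏ _j : Fin p, (Fintype.card V : ℝ) ^ (1 / (p : ℝ)) :=
        prod_le_prod (fun j _ => lpNorm_nonneg _ _)
          fun j _ => lpNorm_levelIndicator_le hp' Q (a j)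
    _ = Fintype.card V := by
        rw [prod_const, card_univ, Fintype.card_fin, ← Real.rpow_natCast,
          ← Real.rpow_mul (by positivity), one_div_mul_cancel hp'.ne', Real.rpow_one]

lemma sum_prod_levelIndicator {V K : Type*} [Fintype K] [DecidableEq K]
    {t : ℕ} (Q : V → K) (P : (Fin t → K) → Prop) [DecidablePred P] (z : Fin t → V) :
    ∑ a with P a, ∏ j, levelIndicator Q (a j) (z j) =
      if P (fun j => Q (z j)) then 1 else 0 := by
  have h (a : Fin t → K) : ∏ j, levelIndicator Q (a j) (z j) =
      if (fun j => Q (z j)) = a then 1 else 0 := by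
    simp only [levelIndicator, Finset.prod_ite_zero, funext_iff, mem_univ, true_implies,
      prod_const_one]
  simp [h, sum_ite_eq]

/-! ### Evaluating the line form -/

lemma evalForm_lineForm (p n : ℕ) [NeZero p] (D : Finset (Fin n → ZMod p))
    (f : Fin p → (Fin n → ZMod p) → ℝ) :
    evalForm (lineForm p n D) f = (1 / (D.card * Nat.factorial p : ℝ)) *
      ∑ y ∈ D, ∑ x : Fin n → ZMod p, ∑ σ : Equiv.Perm (Fin p),
        ∏ j, f j (x + ((σ j).val : ZMod p) • y) := by
  have key (w : Fin p → Fin n → ZMod p) :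
      ∑ z : Fin p → Fin n → ZMod p, (∏ j, if z j = w j then (1 : ℝ) else 0) * ∏ j, f j (z j) =
        ∏ j, f j (w j) := by
    have h (z : Fin p → Fin n → ZMod p) :
        (∏ j, if z j = w j then (1 : ℝ) else 0) = if z = w then 1 else 0 := by
      simp only [Finset.prod_ite_zero, funext_iff, mem_univ, true_implies, prod_const_one]
    simp [h]
  simp only [evalForm, lineForm, mul_assoc, ← mul_sum, sum_mul]
  congr 1
  rw [sum_comm]
  refine sum_congr rfl fun y _ => ?_
  rw [sum_comm]
  refine sum_congr rfl fun x _ => ?_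
  rw [sum_comm]
  exact sum_congr rfl fun σ _ => key fun j => x + ((σ j).val : ZMod p) • y

lemma sum_fin_val_cast {p : ℕ} [NeZero p] {M : Type*} [AddCommMonoid M] (g : ZMod p → M) :
    ∑ j : Fin p, g (j.val : ZMod p) = ∑ k, g k := by
  refine Fintype.sum_bijective (fun j : Fin p => (j.val : ZMod p)) ?_ _ _ fun _ => rfl
  rw [Fintype.bijective_iff_injective_and_card]
  refine ⟨fun i j h => Fin.ext ?_, by simp [ZMod.card]⟩
  have := (ZMod.natCast_eq_natCast_iff' _ _ _).1 h
  rwa [Nat.mod_eq_of_lt i.2, Nat.mod_eq_of_lt j.2] at this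

lemma sum_perm_line {p n : ℕ} [NeZero p] {Q : (Fin n → ZMod p) → ZMod p}
    (hQ : ∀ x y, ∑ k : ZMod p, Q (x + k • y) = -Q y) (x y : Fin n → ZMod p)
    (σ : Equiv.Perm (Fin p)) : ∑ j, Q (x + ((σ j).val : ZMod p) • y) = -Q y := by
  rw [Equiv.sum_comp σ fun j => Q (x + (j.val : ZMod p) • y),
    sum_fin_val_cast fun k => Q (x + k • y), hQ]

lemma evalForm_lineForm_levelIndicator_eq_zero {p n : ℕ} [NeZero p]
    {Q : (Fin n → ZMod p) → ZMod p} (hQ : ∀ x y, ∑ k : ZMod p, Q (x + k • y) = -Q y)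
    {D : Finset (Fin n → ZMod p)} (hD : ∀ y ∈ D, Q y = 0) {a : Fin p → ZMod p}
    (ha : ∑ j, a j ≠ 0) :
    evalForm (lineForm p n D) (fun j => levelIndicator Q (a j)) = 0 := by
  rw [evalForm_lineForm]
  refine mul_eq_zero_of_right _ (sum_eq_zero fun y hy => sum_eq_zero fun x _ =>
    sum_eq_zero fun σ _ => ?_)
  by_contra h
  rw [prod_eq_zero_iff] at h
  push Not at h
  refine ha ?_
  have (j : Fin p) : Q (x + ((σ j).val : ZMod p) • y) = a j := by
    by_contra hj
    exact h j (mem_univ j) (if_neg hj)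
  rw [← sum_congr rfl fun j _ => this j, sum_perm_line hQ, hD y hy, neg_zero]

lemma sum_evalForm_lineForm_univ_levelIndicator {p n : ℕ} [NeZero p]
    {Q : (Fin n → ZMod p) → ZMod p} (hQ : ∀ x y, ∑ k : ZMod p, Q (x + k • y) = -Q y) :
    ∑ a : Fin p → ZMod p with ∑ j, a j ≠ 0,
      evalForm (lineForm p n univ) (fun j => levelIndicator Q (a j)) =
        #{y | Q y ≠ 0} := by
  simp only [evalForm_lineForm, ← mul_sum]
  rw [sum_comm]
  have (y : Fin n → ZMod p) : ∑ a : Fin p → ZMod p with ∑ j, a j ≠ 0,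
      ∑ x : Fin n → ZMod p, ∑ σ : Equiv.Perm (Fin p),
        ∏ j, levelIndicator Q (a j) (x + ((σ j).val : ZMod p) • y) =
      (Fintype.card (Fin n → ZMod p) * Nat.factorial p : ℝ) * if Q y ≠ 0 then 1 else 0 := by
    rw [sum_comm]
    simp_rw [sum_comm (s := univ.filter _)]
    simp only [sum_prod_levelIndicator Q (fun a => ∑ j, a j ≠ 0), sum_perm_line hQ, sum_const,
      card_univ, Fintype.card_perm, Fintype.card_fin, nsmul_eq_mul, neg_ne_zero, mul_assoc]
  have h0 : (Fintype.card (Fin n → ZMod p) * Nat.factorial p : ℝ) ≠ 0 := by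
    have : Fintype.card (Fin n → ZMod p) ≠ 0 := Fintype.card_ne_zero
    have := Nat.factorial_ne_zero p
    positivity
  simp only [this, ← mul_sum, card_univ, sum_boole]
  field_simp

/-- A function whose sum over every line is minus its value at the direction, and which is zero
on `D` but nonzero on a `1 / p` fraction of the space, separates the line form of `D` from the
complete one. -/
lemma le_formNorm_lineForm_sub {p n : ℕ} [NeZero p]
    {Q : (Fin n → ZMod p) → ZMod p} (hQ : ∀ x y, ∑ k : ZMod p, Q (x + k • y) = -Q y)
    {D : Finset (Fin n → ZMod p)} (hD : ∀ y ∈ D, Q y = 0)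
    (hcard : p ^ n ≤ p * #{y | Q y ≠ 0}) :
    1 / (p : ℝ) ^ (p + 1) ≤
      formNorm (p : ℝ) (fun z => lineForm p n D z - lineForm p n univ z) := by
  have hp : 0 < p := Nat.pos_of_neZero p
  have hp' : (0 : ℝ) < p := by exact_mod_cast hp
  set N : ℝ := ((#{y | Q y ≠ 0} : ℕ) : ℝ) with hN
  have hNge : (p : ℝ) ^ n / p ≤ N := by
    rw [div_le_iff₀' hp', hN]
    exact_mod_cast hcard
  have hNpos : 0 < N := lt_of_lt_of_le (by positivity) hNge
  obtain ⟨a, ha, hle⟩ : ∃ a : Fin p → ZMod p, ∑ j, a j ≠ 0 ∧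
      N / p ^ p ≤ evalForm (lineForm p n univ) (fun j => levelIndicator Q (a j)) := by
    by_contra! hlt
    have hsum := sum_evalForm_lineForm_univ_levelIndicator hQ
    have hne : (univ.filter fun a : Fin p → ZMod p => ∑ j, a j ≠ 0).Nonempty := by
      by_contra h
      rw [not_nonempty_iff_eq_empty.1 h, sum_empty] at hsum
      exact hNpos.ne hsum
    have h1 := sum_lt_sum_of_nonempty hne fun a ha => hlt a (mem_filter.1 ha).2
    rw [hsum, sum_const, nsmul_eq_mul] at h1
    have h2 : (#{a : Fin p → ZMod p | ∑ j, a j ≠ 0} : ℝ) ≤ (p : ℝ) ^ p := by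
      have := card_le_univ (univ.filter fun a : Fin p → ZMod p => ∑ j, a j ≠ 0)
      simp only [Fintype.card_pi, ZMod.card, prod_const, card_univ, Fintype.card_fin] at this
      exact_mod_cast this
    have h3 : (#{a : Fin p → ZMod p | ∑ j, a j ≠ 0} : ℝ) * (N / p ^ p) ≤ p ^ p * (N / p ^ p) := by
      gcongr
    rw [mul_div_cancel₀ _ (by positivity)] at h3
    exact absurd h1 (not_lt.2 h3)
  have hpos : 0 < evalForm (lineForm p n univ) (fun j => levelIndicator Q (a j)) :=
    lt_of_lt_of_le (by positivity) hle
  have hx (j : Fin p) : levelIndicator Q (a j) ≠ 0 := fun h =>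
    hpos.ne' (evalForm_eq_zero_of_eq_zero _ (fun j => levelIndicator Q (a j)) h)
  refine le_trans ?_ (div_le_formNorm hp' _ (fun j => levelIndicator Q (a j)) hx)
  rw [evalForm_sub, evalForm_lineForm_levelIndicator_eq_zero hQ hD ha, zero_sub, abs_neg,
    abs_of_pos hpos]
  have hprod : 0 < ∏ j, lpNorm (p : ℝ) (levelIndicator Q (a j)) := prod_pos fun j _ => by
    obtain ⟨v, hv⟩ := Function.ne_iff.1 (hx j)
    exact lt_of_lt_of_le (abs_pos.2 hv) (abs_le_lpNorm hp' _ v)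
  have hprod_le := prod_lpNorm_levelIndicator_le hp Q a
  rw [le_div_iff₀ hprod]
  simp only [Fintype.card_pi, ZMod.card, prod_const, card_univ, Fintype.card_fin,
    Nat.cast_pow] at hprod_le
  calc 1 / (p : ℝ) ^ (p + 1) * ∏ j, lpNorm (p : ℝ) (levelIndicator Q (a j))
      ≤ 1 / (p : ℝ) ^ (p + 1) * p ^ n := by gcongr
    _ = (p : ℝ) ^ n / p / p ^ p := by rw [pow_succ (p : ℝ) p]; field_simp
    _ ≤ N / p ^ p := by gcongr
    _ ≤ _ := hle

/-! ### Squarefree forms -/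

/-- The homogeneous squarefree polynomial of degree `d` with coefficients `c`. -/
noncomputable def squarefreeForm {K : Type*} [CommSemiring K] {n d : ℕ}
    (c : powersetCard d (univ : Finset (Fin n)) → K) : MvPolynomial (Fin n) K :=
  ∑ S, MvPolynomial.C (c S) * ∏ i ∈ S.1, MvPolynomial.X i

lemma eval_squarefreeForm {K : Type*} [CommSemiring K] {n d : ℕ}
    (c : powersetCard d (univ : Finset (Fin n)) → K) (x : Fin n → K) :
    MvPolynomial.eval x (squarefreeForm c) = ∑ S, c S * ∏ i ∈ S.1, x i := by
  simp [squarefreeForm]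

lemma totalDegree_squarefreeForm_le {K : Type*} [CommSemiring K] {n d : ℕ}
    (c : powersetCard d (univ : Finset (Fin n)) → K) :
    (squarefreeForm c).totalDegree ≤ d := by
  refine MvPolynomial.IsHomogeneous.totalDegree_le
    (MvPolynomial.IsHomogeneous.sum _ _ _ fun S _ => ?_)
  have := (MvPolynomial.isHomogeneous_C (Fin n) (c S)).mul
    (MvPolynomial.IsHomogeneous.prod S.1 _ (fun _ => 1) fun i _ => MvPolynomial.isHomogeneous_X K i)
  simpa [(mem_powersetCard.1 S.2).2] using this

lemma squarefreeForm_ne_zero {K : Type*} [CommSemiring K] {n d : ℕ}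
    {c : powersetCard d (univ : Finset (Fin n)) → K} (hc : c ≠ 0) : squarefreeForm c ≠ 0 := by
  obtain ⟨S, hS⟩ := Function.ne_iff.1 hc
  intro h
  refine hS ?_
  have heval := eval_squarefreeForm c fun i => if i ∈ S.1 then 1 else 0
  rw [h, map_zero, sum_eq_single S] at heval
  · rw [prod_congr rfl fun i hi => if_pos hi] at heval
    simpa using heval.symm
  · intro T _ hTS
    have : ¬ T.1 ⊆ S.1 := fun hsub => hTS (Subtype.ext (eq_of_subset_of_card_le hsub (by
      rw [(mem_powersetCard.1 T.2).2, (mem_powersetCard.1 S.2).2])))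
    obtain ⟨i, hiT, hiS⟩ := not_subset.1 this
    rw [prod_eq_zero hiT (if_neg hiS), mul_zero]
  · simp

lemma exists_squarefreeForm_eq_zero_on {K : Type*} [Field K] {n d : ℕ}
    (D : Finset (Fin n → K)) (hD : #D < n.choose d) :
    ∃ c : powersetCard d (univ : Finset (Fin n)) → K, c ≠ 0 ∧
      ∀ y ∈ D, MvPolynomial.eval y (squarefreeForm c) = 0 := by
  let M : Matrix D (powersetCard d (univ : Finset (Fin n))) K :=
    Matrix.of fun y S => ∏ i ∈ S.1, y.1 i
  have hker : LinearMap.ker M.mulVecLin ≠ ⊥ := LinearMap.ker_ne_bot_of_finrank_lt (by simpa)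
  obtain ⟨c, hc, hc0⟩ := (Submodule.ne_bot_iff _).1 hker
  refine ⟨c, hc0, fun y hy => ?_⟩
  have := congrFun (LinearMap.mem_ker.1 hc) ⟨y, hy⟩
  simpa [M, eval_squarefreeForm, Matrix.mulVec, dotProduct, mul_comm] using this

lemma sum_pow_card_sub_one {p : ℕ} [Fact p.Prime] : ∑ k : ZMod p, k ^ (p - 1) = -1 := by
  have h (k : ZMod p) : k ^ (p - 1) = 1 - if k = 0 then 1 else 0 := by
    split_ifs with hk
    · simp [hk, Nat.sub_ne_zero_of_lt (Fact.out : p.Prime).one_lt]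
    · rw [ZMod.pow_card_sub_one_eq_one hk, sub_zero]
  simp [h, sum_sub_distrib]

lemma sum_prod_line {p n : ℕ} [Fact p.Prime] {S : Finset (Fin n)} (hS : #S = p - 1)
    (x y : Fin n → ZMod p) : ∑ k : ZMod p, ∏ i ∈ S, (x + k • y) i = -∏ i ∈ S, y i := by
  have hexp (k : ZMod p) : ∏ i ∈ S, (x + k • y) i =
      ∑ T ∈ S.powerset, ((∏ i ∈ T, y i) * ∏ i ∈ S \ T, x i) * k ^ #T := by
    simp only [Pi.add_apply, Pi.smul_apply, smul_eq_mul, add_comm (x _)]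
    rw [prod_add]
    refine sum_congr rfl fun T _ => ?_
    rw [prod_mul_distrib, prod_const]
    ring
  simp only [hexp]
  rw [sum_comm]
  simp only [← mul_sum]
  rw [sum_eq_single S]
  · rw [hS, sum_pow_card_sub_one]
    simp
  · intro T hT hTS
    have hlt : #T < p - 1 := hS ▸ card_lt_card ((mem_powerset.1 hT).ssubset_of_ne hTS)
    rw [FiniteField.sum_pow_lt_card_sub_one (ZMod p) _ (by rwa [ZMod.card]), mul_zero]
  · simp

lemma sum_squarefreeForm_line {p n : ℕ} [Fact p.Prime]
    (c : powersetCard (p - 1) (univ : Finset (Fin n)) → ZMod p) (x y : Fin n → ZMod p) :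
    ∑ k : ZMod p, MvPolynomial.eval (x + k • y) (squarefreeForm c) =
      -MvPolynomial.eval y (squarefreeForm c) := by
  simp only [eval_squarefreeForm]
  rw [sum_comm, ← sum_neg_distrib]
  refine sum_congr rfl fun S _ => ?_
  rw [← mul_sum, sum_prod_line (mem_powersetCard.1 S.2).2, mul_neg]

lemma pow_le_mul_card_eval_ne_zero {p n : ℕ} [Fact p.Prime] {P : MvPolynomial (Fin n) (ZMod p)}
    (hP : P ≠ 0) (hdeg : P.totalDegree ≤ p - 1) :
    p ^ n ≤ p * #{y | MvPolynomial.eval y P ≠ 0} := by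
  have hp : 0 < p := (Fact.out : p.Prime).pos
  have hp' : (0 : ℚ≥0) < p := by exact_mod_cast hp
  have hsz := MvPolynomial.schwartz_zippel_totalDegree hP univ
  rw [Fintype.piFinset_univ, card_univ, ZMod.card, div_le_div_iff₀ (by positivity) hp'] at hsz
  have hzero : #{y | MvPolynomial.eval y P = 0} * p ≤ (p - 1) * p ^ n :=
    le_trans (by exact_mod_cast hsz) (Nat.mul_le_mul_right _ hdeg)
  have hsplit := card_filter_add_card_filter_not (s := (univ : Finset (Fin n → ZMod p)))
    fun y => MvPolynomial.eval y P = 0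
  simp only [card_univ, Fintype.card_pi, ZMod.card, prod_const, Fintype.card_fin] at hsplit
  obtain ⟨q, rfl⟩ := Nat.exists_eq_add_of_lt hp
  simp only [Nat.zero_add, Nat.add_sub_cancel, ne_eq] at *
  nlinarith

lemma pow_div_le_choose {p n : ℕ} (hp : 0 < p) (hn : p ^ 2 ≤ n) :
    1 / (2 ^ (p - 1) * (p - 1).factorial : ℝ) * (n : ℝ) ^ (p - 1) ≤ n.choose (p - 1) := by
  refine le_trans ?_ (Nat.pow_le_choose (p - 1) n)
  have h : (n : ℝ) / 2 ≤ ((n + 1 - (p - 1) : ℕ) : ℝ) := by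
    rw [div_le_iff₀ two_pos]
    have : n ≤ (n + 1 - (p - 1)) * 2 := by
      have : 2 * p ≤ n + 1 := by nlinarith [sq_nonneg ((p : ℤ) - 1)]
      omega
    exact_mod_cast this
  calc 1 / (2 ^ (p - 1) * (p - 1).factorial : ℝ) * (n : ℝ) ^ (p - 1)
      = ((n : ℝ) / 2) ^ (p - 1) / (p - 1).factorial := by rw [div_pow]; field_simp
    _ ≤ _ := by gcongr

/-- for every prime `p ≥ 3` there exist `ε(p), δ(p) > 0` such that for every
`n ≥ p²` and every nonempty `D ⊆ 𝔽_p^n` with `|D| < δ(p) n^{p−1}`, one has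
`‖A_{L_D} − A_{L_{𝔽_p^n}}‖_{ℓ_p,…,ℓ_p} ≥ ε(p)`. -/
theorem stmt2 (p : ℕ) [NeZero p] (hp : p.Prime) (hp3 : 3 ≤ p) :
    ∃ ε δ : ℝ, 0 < ε ∧ 0 < δ ∧
      ∀ n : ℕ, p ^ 2 ≤ n →
      ∀ D : Finset (Fin n → ZMod p), D.Nonempty →
        (D.card : ℝ) < δ * (n : ℝ) ^ (p - 1) →
        ε ≤ formNorm (p : ℝ)
          (fun z => lineForm p n D z - lineForm p n (Finset.univ) z) := by
  have : Fact p.Prime := ⟨hp⟩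
  have hp0 : (0 : ℝ) < p := by exact_mod_cast hp.pos
  refine ⟨1 / (p : ℝ) ^ (p + 1), 1 / (2 ^ (p - 1) * (p - 1).factorial : ℝ), by positivity,
    by positivity, fun n hn D _ hD => ?_⟩
  have hlt : #D < n.choose (p - 1) := by
    exact_mod_cast hD.trans_le (pow_div_le_choose hp.pos hn)
  obtain ⟨c, hc, hzero⟩ := exists_squarefreeForm_eq_zero_on D hlt
  exact le_formNorm_lineForm_sub (sum_squarefreeForm_line c) hzero
    (pow_le_mul_card_eval_ne_zero (squarefreeForm_ne_zero hc) (totalDegree_squarefreeForm_le c))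
end

section
/- Let p be a prime, let n ≥ p² be an integer, and let D ⊆ 𝔽_p^n be a set of size |D| < binom(n+p−2, p−1). Then there exist disjoint sets T₁, T₂ ⊆ 𝔽_p^n such that the p-fold combinatorial rectangle R = T₁ × T₂ × ⋯ × T₂ contains at least p^{2n+p−p²} lines (i.e. there are at least p^{2n+p−p²} pairs (x,d) ∈ 𝔽_p^n × 𝔽_p^n such that R contains ℓ_{x,d}), but R contains no line ℓ_{x,d} with direction d ∈ D. -/
open MvPolynomial

/-- A nonzero polynomial over a finite field has a monomial `a` such that the polynomial is nonzero
at no fewer than `∏ i, (q - a i)` points. -/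
theorem exists_mem_support_prod_card_sub_le {K : Type*} [Field K] [Fintype K] [DecidableEq K] :
    ∀ {N : ℕ} {f : MvPolynomial (Fin N) K}, f ≠ 0 → ∃ a ∈ f.support,
      ∏ i, (Fintype.card K - a i) ≤ (Finset.univ.filter fun x => eval x f ≠ 0).card
  | 0, f, hf => by
    obtain ⟨a, ha⟩ := support_nonempty.mpr hf
    refine ⟨a, ha, ?_⟩
    rw [f.eq_C_of_isEmpty] at hf ⊢
    simp [C_ne_zero.mp hf]
  | N + 1, f, hf => by
    set g := finSuccEquiv K N f with hg
    have hg₀ : g ≠ 0 := EmbeddingLike.map_ne_zero_iff.2 hf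
    obtain ⟨b, hb, hcard⟩ :=
      exists_mem_support_prod_card_sub_le (Polynomial.leadingCoeff_ne_zero.mpr hg₀)
    refine ⟨b.cons g.natDegree, mem_support_coeff_finSuccEquiv.mp hb, ?_⟩
    have hfiber : ∀ y : Fin N → K, eval y g.leadingCoeff ≠ 0 →
        Fintype.card K - g.natDegree ≤
          (Finset.univ.filter fun t => eval (Fin.cons t y : Fin (N + 1) → K) f ≠ 0).card := by
      intro y hy
      set r := g.map (eval y) with hr
      have hdeg : r.natDegree = g.natDegree :=
        Polynomial.natDegree_map_of_leadingCoeff_ne_zero _ hy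
      have hr₀ : r ≠ 0 := fun h => hy <| by
        rw [Polynomial.leadingCoeff, ← Polynomial.coeff_map, ← hr, h, Polynomial.coeff_zero]
      have hroots : (Finset.univ.filter fun t => eval (Fin.cons t y : Fin (N + 1) → K) f = 0).card
          ≤ g.natDegree := calc
        _ ≤ r.roots.toFinset.card := by
          apply Finset.card_le_card
          intro t ht
          rw [Finset.mem_filter, eval_eq_eval_mv_eval'] at ht
          rw [Multiset.mem_toFinset, Polynomial.mem_roots hr₀]
          exact ht.2
        _ ≤ r.roots.card := r.roots.toFinset_card_le
        _ ≤ r.natDegree := r.card_roots'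
        _ = g.natDegree := hdeg
      have hsplit := Finset.card_filter_add_card_filter_not (s := (Finset.univ : Finset K))
        (fun t => eval (Fin.cons t y : Fin (N + 1) → K) f = 0)
      rw [Finset.card_univ] at hsplit
      simp only [ne_eq]
      omega
    rw [Fin.prod_univ_succ]
    simp only [Finsupp.cons_zero, Finsupp.cons_succ]
    calc (Fintype.card K - g.natDegree) * ∏ i, (Fintype.card K - b i)
        ≤ (Finset.univ.filter fun y => eval y g.leadingCoeff ≠ 0).card *
            (Fintype.card K - g.natDegree) := by
          rw [mul_comm]; gcongr
      _ ≤ ∑ y ∈ Finset.univ.filter fun y => eval y g.leadingCoeff ≠ 0,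
            (Finset.univ.filter fun t => eval (Fin.cons t y : Fin (N + 1) → K) f ≠ 0).card := by
          rw [← smul_eq_mul]
          exact Finset.card_nsmul_le_sum _ _ _ fun y hy => hfiber y (Finset.mem_filter.mp hy).2
      _ = ((Finset.univ.filter fun y => eval y g.leadingCoeff ≠ 0).sigma fun y =>
            Finset.univ.filter fun t => eval (Fin.cons t y : Fin (N + 1) → K) f ≠ 0).card :=
          (Finset.card_sigma _ _).symm
      _ ≤ _ := by
          refine Finset.card_le_card_of_injOn
            (fun z => (Fin.cons z.2 z.1 : Fin (N + 1) → K)) ?_ ?_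
          · intro z hz
            simp only [Finset.coe_sigma, Set.mem_sigma_iff, Finset.mem_coe, Finset.mem_filter] at hz
            simpa using hz.2.2
          · rintro ⟨y, t⟩ - ⟨y', t'⟩ - h
            obtain ⟨rfl, rfl⟩ := Fin.cons_inj.mp h
            rfl

/-- The exponent `e` reduced modulo `x ^ q = x`. -/
def reducedExponent (q e : ℕ) : ℕ := if e = 0 then 0 else (e - 1) % (q - 1) + 1

theorem reducedExponent_le (q e : ℕ) : reducedExponent q e ≤ e := by
  unfold reducedExponent
  split_ifs with h
  · omega
  · have := Nat.mod_le (e - 1) (q - 1); omega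

theorem reducedExponent_lt {q : ℕ} (hq : 1 < q) (e : ℕ) : reducedExponent q e < q := by
  unfold reducedExponent
  split_ifs with h
  · omega
  · have := Nat.mod_lt (e - 1) (y := q - 1) (by omega); omega

theorem pow_reducedExponent {K : Type*} [Field K] [Fintype K] (x : K) (e : ℕ) :
    x ^ reducedExponent (Fintype.card K) e = x ^ e := by
  unfold reducedExponent
  split_ifs with h
  · rw [h]
  · rcases eq_or_ne x 0 with rfl | hx
    · rw [zero_pow h, zero_pow (by omega)]
    · conv_rhs => rw [show e = (e - 1) + 1 by omega, pow_succ,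
        ← Nat.mod_add_div (e - 1) (Fintype.card K - 1), pow_add, pow_mul,
        FiniteField.pow_card_sub_one_eq_one x hx, one_pow, mul_one]
      rw [pow_succ]

/-- Every polynomial over a finite field agrees, as a function, with one having all exponents
less than `q` and no larger total degree. -/
theorem exists_reduced_polynomial {K σ : Type*} [Field K] [Fintype K] [Fintype σ]
    (f : MvPolynomial σ K) : ∃ g : MvPolynomial σ K, (∀ x, eval x g = eval x f) ∧
      ∀ a ∈ g.support, (∀ i, a i < Fintype.card K) ∧ ∑ i, a i ≤ f.totalDegree := by
  classical
  let ρ : (σ →₀ ℕ) → (σ →₀ ℕ) :=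
    fun a => Finsupp.equivFunOnFinite.symm fun i => reducedExponent (Fintype.card K) (a i)
  refine ⟨∑ a ∈ f.support, monomial (ρ a) (f.coeff a), fun x => ?_, fun a ha => ?_⟩
  · rw [map_sum, eval_eq']
    refine Finset.sum_congr rfl fun a _ => ?_
    rw [eval_monomial, Finsupp.prod_fintype _ _ (by simp)]
    simp [ρ, pow_reducedExponent]
  · obtain ⟨b, hb, hab⟩ := Finset.mem_biUnion.mp (support_sum ha)
    obtain rfl := Finset.mem_singleton.mp (support_monomial_subset hab)
    refine ⟨fun i => reducedExponent_lt Fintype.one_lt_card _, ?_⟩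
    calc ∑ i, ρ b i ≤ ∑ i, b i := Finset.sum_le_sum fun i _ => reducedExponent_le _ _
      _ = b.sum fun _ e => e := by rw [Finsupp.sum_fintype _ _ fun _ => rfl]
      _ ≤ f.totalDegree := le_totalDegree hb

theorem succ_pow_le_succ_pow {b m : ℕ} (h : b ≤ m) : (m + 1) ^ b ≤ (b + 1) ^ m := by
  rcases Nat.eq_zero_or_pos b with rfl | hb
  · simp
  have hb' : (0 : ℝ) < b := by exact_mod_cast hb
  have key := one_add_mul_self_le_rpow_one_add (s := (b : ℝ)) (by linarith) (p := m / b)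
    (by rw [one_le_div hb']; exact_mod_cast h)
  rw [div_mul_cancel₀ _ hb'.ne'] at key
  have key' := pow_le_pow_left₀ (by positivity) key b
  rw [← Real.rpow_natCast (_ ^ _), ← Real.rpow_mul (by positivity), div_mul_cancel₀ _ hb'.ne',
    Real.rpow_natCast] at key'
  have : ((m + 1 : ℕ) : ℝ) ^ b ≤ ((b + 1 : ℕ) : ℝ) ^ m := by
    push_cast; rwa [add_comm (m : ℝ), add_comm (b : ℝ)]
  exact_mod_cast this

theorem pow_card_sub_one_le {q a : ℕ} (h : a < q) : q ^ (q - 1) ≤ (q - a) ^ (q - 1) * q ^ a := by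
  have key := succ_pow_le_succ_pow (b := q - 1 - a) (m := q - 1) (by omega)
  rw [show q - 1 + 1 = q by omega, show q - 1 - a + 1 = q - a by omega] at key
  calc q ^ (q - 1) = q ^ (q - 1 - a) * q ^ a := by rw [← pow_add]; congr 1; omega
    _ ≤ _ := by gcongr

/-- A polynomial over a finite field of degree at most `(q - 1) * k` that is not identically zero
as a function is nonzero at no fewer than `q ^ (N - k)` points. -/
theorem pow_sub_le_card_eval_ne_zero {K : Type*} [Field K] [Fintype K] [DecidableEq K] {N k : ℕ}
    (f : MvPolynomial (Fin N) K) (hf : ∃ x, eval x f ≠ 0)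
    (hdeg : f.totalDegree ≤ (Fintype.card K - 1) * k) (hk : k ≤ N) :
    Fintype.card K ^ (N - k) ≤ (Finset.univ.filter fun x => eval x f ≠ 0).card := by
  obtain ⟨g, hg, hsupp⟩ := exists_reduced_polynomial f
  simp_rw [← hg] at hf ⊢
  have hg₀ : g ≠ 0 := by rintro rfl; simp at hf
  obtain ⟨a, ha, hcard⟩ := exists_mem_support_prod_card_sub_le hg₀
  obtain ⟨hlt, hsum⟩ := hsupp a ha
  refine le_trans ?_ hcard
  set q := Fintype.card K
  have hq : 1 < q := Fintype.one_lt_card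
  rw [← Nat.pow_le_pow_iff_left (n := q - 1) (by omega)]
  have key : q ^ ((q - 1) * N) ≤ (∏ i, (q - a i)) ^ (q - 1) * q ^ ((q - 1) * k) := calc
    q ^ ((q - 1) * N) = ∏ _i : Fin N, q ^ (q - 1) := by simp [pow_mul]
    _ ≤ ∏ i, ((q - a i) ^ (q - 1) * q ^ a i) :=
      Finset.prod_le_prod' fun i _ => pow_card_sub_one_le (hlt i)
    _ = (∏ i, (q - a i)) ^ (q - 1) * q ^ ∑ i, a i := by
      rw [Finset.prod_mul_distrib, Finset.prod_pow, Finset.prod_pow_eq_pow_sum]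
    _ ≤ _ := by
      gcongr
      · omega
      · exact hsum.trans hdeg
  refine Nat.le_of_mul_le_mul_right ?_ (show 0 < q ^ ((q - 1) * k) by positivity)
  refine le_trans (le_of_eq ?_) key
  rw [← pow_mul, ← pow_add, mul_comm (N - k), ← mul_add, Nat.sub_add_cancel hk]

theorem exists_isHomogeneous_vanishing {K σ : Type*} [Field K] [Fintype σ]
    {m : ℕ} (D : Finset (σ → K)) (hD : D.card < (Fintype.card σ + m - 1).choose m) :
    ∃ H : MvPolynomial σ K, H ≠ 0 ∧ H.IsHomogeneous m ∧ ∀ d ∈ D, eval d H = 0 := by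
  classical
  let A := (Finset.univ : Finset σ).finsuppAntidiag m
  let P : (A → K) →ₗ[K] MvPolynomial σ K := ∑ a : A, (monomial a.1) ∘ₗ LinearMap.proj a
  have hP (c : A → K) : P c = ∑ a : A, monomial a.1 (c a) := by simp [P]
  let E : (A → K) →ₗ[K] (D → K) := LinearMap.pi fun d => (aeval d.1).toLinearMap ∘ₗ P
  have hE : LinearMap.ker E ≠ ⊥ := by
    apply LinearMap.ker_ne_bot_of_finrank_lt
    simpa [A, Finset.card_finsuppAntidiag_nat_eq_choose] using hD
  obtain ⟨c, hc, hc₀⟩ := Submodule.exists_mem_ne_zero_of_ne_bot hE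
  refine ⟨P c, fun h => hc₀ ?_, ?_, fun d hd => ?_⟩
  · ext a
    have := congrArg (coeff a.1) h
    rw [hP, coeff_sum, Finset.sum_eq_single a] at this
    · simpa using this
    · intro b _ hb
      rw [coeff_monomial, if_neg fun h => hb (Subtype.ext h)]
    · simp
  · rw [hP]
    refine IsHomogeneous.sum _ _ _ fun a _ => isHomogeneous_monomial _ ?_
    rw [Finsupp.degree_eq_sum]
    exact (Finset.mem_finsuppAntidiag.mp a.2).1
  · have := congrFun (LinearMap.mem_ker.mp hc) ⟨d, hd⟩
    simpa [E, aeval_eq_eval] using this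

theorem sum_ite_eq_zero_eq_neg {K : Type*} [Field K] [Fintype K] [DecidableEq K] (h : K) :
    ∑ t : K, (if t = 0 then 0 else h) = -h := calc
  _ = ∑ t : K, (h - if t = 0 then h else 0) :=
    Finset.sum_congr rfl fun t _ => by split_ifs <;> simp
  _ = -h := by simp [Finset.sum_sub_distrib]

theorem sum_eval_eq_neg_coeff {K : Type*} [Field K] [Fintype K] (r : Polynomial K)
    (hr : r.natDegree ≤ Fintype.card K - 1) :
    ∑ t, r.eval t = -r.coeff (Fintype.card K - 1) := by
  classical
  have hq : 1 < Fintype.card K := Fintype.one_lt_card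
  have hpow : ∑ t : K, t ^ (Fintype.card K - 1) = -1 := by
    rw [← sum_ite_eq_zero_eq_neg]
    refine Finset.sum_congr rfl fun t _ => ?_
    split_ifs with ht
    · rw [ht, zero_pow (by omega)]
    · exact FiniteField.pow_card_sub_one_eq_one t ht
  simp_rw [Polynomial.eval_eq_sum_range' (Nat.lt_succ_of_le hr)]
  rw [Finset.sum_comm, Finset.sum_range_succ, Finset.sum_eq_zero, zero_add, ← Finset.mul_sum,
    hpow, mul_neg, mul_one]
  intro i hi
  rw [← Finset.mul_sum, FiniteField.sum_pow_lt_card_sub_one K i (Finset.mem_range.mp hi), mul_zero]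

theorem natDegree_le_and_coeff_prod_linear_pow {K σ : Type*} [Field K] (x d : σ → K) (a : σ → ℕ)
    (s : Finset σ) :
    (∏ i ∈ s, (Polynomial.C (d i) * Polynomial.X + Polynomial.C (x i)) ^ a i).natDegree
        ≤ ∑ i ∈ s, a i ∧
      (∏ i ∈ s, (Polynomial.C (d i) * Polynomial.X + Polynomial.C (x i)) ^ a i).coeff
        (∑ i ∈ s, a i) = ∏ i ∈ s, d i ^ a i := by
  classical
  induction s using Finset.induction_on with
  | empty => simp
  | insert j s hj ih =>
    have hlin : (Polynomial.C (d j) * Polynomial.X + Polynomial.C (x j)).natDegree ≤ 1 :=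
      Polynomial.natDegree_linear_le
    have hpow := Polynomial.natDegree_pow_le_of_le (a j) hlin
    have hcoeff := Polynomial.coeff_pow_of_natDegree_le (m := a j) hlin
    rw [mul_one] at hpow hcoeff
    simp only [Finset.prod_insert hj, Finset.sum_insert hj]
    refine ⟨Polynomial.natDegree_mul_le_of_le hpow ih.1, ?_⟩
    rw [Polynomial.coeff_mul_add_eq_of_natDegree_le hpow ih.1, ih.2, hcoeff]
    simp

theorem sum_eq_of_mem_support_of_isHomogeneous {K σ : Type*} [CommSemiring K] [Fintype σ] {m : ℕ}
    {H : MvPolynomial σ K} (hH : H.IsHomogeneous m) {a : σ →₀ ℕ} (ha : a ∈ H.support) :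
    ∑ i, a i = m := by
  rw [← hH (mem_support_iff.mp ha), ← Finsupp.degree_eq_sum, Finsupp.degree_eq_weight_one]
  rfl

theorem eval_smul_of_isHomogeneous {K σ : Type*} [CommSemiring K] [Fintype σ] {m : ℕ}
    {H : MvPolynomial σ K} (hH : H.IsHomogeneous m) (t : K) (d : σ → K) :
    eval (t • d) H = t ^ m * eval d H := by
  rw [eval_eq', eval_eq', Finset.mul_sum]
  refine Finset.sum_congr rfl fun a ha => ?_
  simp only [Pi.smul_apply, smul_eq_mul, mul_pow, Finset.prod_mul_distrib,
    Finset.prod_pow_eq_pow_sum, sum_eq_of_mem_support_of_isHomogeneous hH ha]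
  ring

/-- The values of a form of degree `q - 1` along a line sum to minus its value at the direction. -/
theorem sum_eval_line {K σ : Type*} [Field K] [Fintype K] [Fintype σ] {H : MvPolynomial σ K}
    (hH : H.IsHomogeneous (Fintype.card K - 1)) (x d : σ → K) :
    ∑ t : K, eval (x + t • d) H = -eval d H := by
  simp_rw [eval_eq']
  rw [Finset.sum_comm, ← Finset.sum_neg_distrib]
  refine Finset.sum_congr rfl fun a ha => ?_
  have hdeg := sum_eq_of_mem_support_of_isHomogeneous hH ha
  obtain ⟨hnat, hcoeff⟩ := natDegree_le_and_coeff_prod_linear_pow x d a Finset.univ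
  rw [hdeg] at hnat hcoeff
  have key := sum_eval_eq_neg_coeff _ hnat
  rw [hcoeff] at key
  rw [← Finset.mul_sum, ← mul_neg, ← key]
  refine congrArg _ (Finset.sum_congr rfl fun t _ => ?_)
  rw [Polynomial.eval_prod]
  refine Finset.prod_congr rfl fun i _ => ?_
  simp [add_comm (x i), mul_comm t]

theorem exists_eval_ne_zero_of_isHomogeneous.{u} {K σ : Type u} [Field K] [Fintype K] [Fintype σ]
    {H : MvPolynomial σ K} (hH : H.IsHomogeneous (Fintype.card K - 1)) (hH₀ : H ≠ 0) :
    ∃ d, eval d H ≠ 0 := by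
  by_contra! h
  refine hH₀ (eq_zero_of_eval_eq_zero σ K H h ((mem_restrictDegree _ _ _).mpr fun a ha i => ?_))
  rw [← sum_eq_of_mem_support_of_isHomogeneous hH ha]
  exact Finset.single_le_sum (fun _ _ => Nat.zero_le _) (Finset.mem_univ i)

/-- If a form of degree `q - 1` and values `c t` admit one line along which the form takes the
prescribed values, then they admit at least `q ^ (2 * n - q * (q - 1))` such lines. -/
theorem pow_le_card_lines {K : Type*} [Field K] [Fintype K] [DecidableEq K] {n : ℕ}
    {H : MvPolynomial (Fin n) K} (hH : H.IsHomogeneous (Fintype.card K - 1)) (c : K → K)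
    (hex : ∃ x d : Fin n → K, ∀ t, eval (x + t • d) H = c t)
    (hn : Fintype.card K * (Fintype.card K - 1) ≤ n + n) :
    Fintype.card K ^ (n + n - Fintype.card K * (Fintype.card K - 1)) ≤
      (Finset.univ.filter fun xd : (Fin n → K) × (Fin n → K) =>
        ∀ t, eval (xd.1 + t • xd.2) H = c t).card := by
  set q := Fintype.card K with hq
  have hq₁ : 1 < q := Fintype.one_lt_card
  let L (t : K) : MvPolynomial (Fin (n + n)) K :=
    aeval (fun i => X (Fin.castAdd n i) + C t * X (Fin.natAdd n i)) H
  have hL (t : K) (z : Fin (n + n) → K) :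
      eval z (L t) = eval (fun i => z (Fin.castAdd n i) + t * z (Fin.natAdd n i)) H := by
    simp only [L, ← coe_aeval_eq_eval, RingHom.coe_coe, ← AlgHom.comp_apply, comp_aeval]
    simp
  have hLdeg (t : K) : (L t).totalDegree ≤ q - 1 := by
    refine (IsHomogeneous.totalDegree_le (n := 1 * (q - 1)) ?_).trans (one_mul _).le
    exact hH.aeval _ fun i => (isHomogeneous_X _ _).add <| by
      simpa using (isHomogeneous_C _ t).mul (isHomogeneous_X K (Fin.natAdd n i))
  let Q : MvPolynomial (Fin (n + n)) K := ∏ t, (1 - (L t - C (c t)) ^ (q - 1))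
  have hQ (z : Fin (n + n) → K) : eval z Q ≠ 0 ↔ ∀ t, eval z (L t) = c t := by
    simp only [Q, map_prod, Finset.prod_ne_zero_iff, Finset.mem_univ, true_imp_iff]
    refine forall_congr' fun t => ?_
    rcases eq_or_ne (eval z (L t)) (c t) with h | h
    · simp [h, zero_pow (show q - 1 ≠ 0 by omega)]
    · simp [h, hq, FiniteField.pow_card_sub_one_eq_one _ (sub_ne_zero.mpr h)]
  have hQdeg : Q.totalDegree ≤ (q - 1) * (q * (q - 1)) := by
    refine (totalDegree_finsetProd _ _).trans ?_
    calc _ ≤ ∑ _t : K, (q - 1) * (q - 1) := by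
          refine Finset.sum_le_sum fun t _ => (totalDegree_sub _ _).trans (max_le (by simp) ?_)
          refine (totalDegree_pow _ _).trans (Nat.mul_le_mul_left _ ?_)
          exact (totalDegree_sub_C_le _ _).trans (hLdeg t)
      _ = _ := by simp [← hq]; ring
  obtain ⟨x, d, hxd⟩ := hex
  refine (pow_sub_le_card_eval_ne_zero Q ⟨Fin.append x d, (hQ _).mpr fun t => ?_⟩ hQdeg hn).trans ?_
  · rw [← hxd, hL]
    simp only [Fin.append_left, Fin.append_right]
    rfl
  · refine Finset.card_le_card_of_injOn
      (fun z => (fun i => z (Fin.castAdd n i), fun i => z (Fin.natAdd n i))) ?_ ?_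
    · intro z hz
      have hz' := (hQ z).mp (Finset.mem_filter.mp hz).2
      refine Finset.mem_filter.mpr ⟨Finset.mem_univ _, fun t => ?_⟩
      rw [← hz', hL]
      rfl
    · intro z _ w _ h
      ext i
      obtain ⟨h₁, h₂⟩ := Prod.ext_iff.mp h
      exact Fin.addCases (fun i => congrFun h₁ i) (fun i => congrFun h₂ i) i

/-- for a prime `p`, `n ≥ p²` and `D ⊆ 𝔽_p^n` with
`|D| < binom(n+p−2, p−1)`, there are disjoint `T₁, T₂ ⊆ 𝔽_p^n` such that the rectangle
`R = T₁ × T₂ × ⋯ × T₂` contains at least `p^{2n+p−p²}` lines (pairs `(x,d)` with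
`x + λd ∈ T_{λ+1}` for all `λ ∈ 𝔽_p`), but no line `ℓ_{x,d}` with direction `d ∈ D`. -/
theorem stmt8 (p n : ℕ) [NeZero p] (hp : p.Prime) (hn : p ^ 2 ≤ n)
    (D : Finset (Fin n → ZMod p)) (hD : D.card < (n + p - 2).choose (p - 1)) :
    ∃ T₁ T₂ : Finset (Fin n → ZMod p), Disjoint T₁ T₂ ∧
      p ^ (2 * n + p - p ^ 2) ≤
        ((Finset.univ ×ˢ (Finset.univ : Finset (Fin n → ZMod p))).filter
          (fun xd : (Fin n → ZMod p) × (Fin n → ZMod p) =>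
            ∀ lam : ZMod p, xd.1 + lam • xd.2 ∈ (if lam = 0 then T₁ else T₂))).card ∧
      ∀ x d : Fin n → ZMod p, d ∈ D →
        ¬ (∀ lam : ZMod p, x + lam • d ∈ (if lam = 0 then T₁ else T₂)) := by
  have : Fact p.Prime := ⟨hp⟩
  have hp₁ := hp.one_lt
  have hcard : Fintype.card (ZMod p) = p := ZMod.card p
  obtain ⟨H, hH₀, hH, hvan⟩ := exists_isHomogeneous_vanishing (m := p - 1) D
    (by rwa [Fintype.card_fin, show n + (p - 1) - 1 = n + p - 2 by omega])
  replace hH : H.IsHomogeneous (Fintype.card (ZMod p) - 1) := by rwa [ZMod.card]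
  obtain ⟨d₀, hd₀⟩ := exists_eval_ne_zero_of_isHomogeneous hH hH₀
  set h := eval d₀ H
  let c : ZMod p → ZMod p := fun t => if t = 0 then 0 else h
  have hmem (y : Fin n → ZMod p) (t : ZMod p) :
      (y ∈ if t = 0 then Finset.univ.filter fun y => eval y H = 0
        else Finset.univ.filter fun y => eval y H = h) ↔ eval y H = c t := by
    by_cases ht : t = 0 <;> simp [ht, c]
  refine ⟨Finset.univ.filter fun y => eval y H = 0, Finset.univ.filter fun y => eval y H = h,
    ?_, ?_, fun x d hd hline => ?_⟩
  · exact Finset.disjoint_filter.mpr fun y _ hy hy' => hd₀ (hy'.symm.trans hy)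
  · simp_rw [hmem]
    have hpp : p * (p - 1) + p = p ^ 2 := by
      rw [Nat.mul_sub_one, Nat.sub_add_cancel (Nat.le_mul_self p), sq]
    have key := pow_le_card_lines hH c ⟨0, d₀, fun t => ?_⟩ (by rw [hcard]; omega)
    · rw [hcard, show n + n - p * (p - 1) = 2 * n + p - p ^ 2 by omega] at key
      simpa using key
    · rw [zero_add, eval_smul_of_isHomogeneous hH, hcard]
      by_cases ht : t = 0
      · simp [ht, c, zero_pow (show p - 1 ≠ 0 by omega)]
      · simp [ht, c, h, ZMod.pow_card_sub_one_eq_one ht]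
  · simp_rw [hmem] at hline
    have key := sum_eval_line hH x d
    rw [hvan d hd, neg_zero, Finset.sum_congr rfl fun t _ => hline t] at key
    exact hd₀ (neg_eq_zero.mp ((sum_ite_eq_zero_eq_neg h).symm.trans key))
end

section
/- Let p be a prime, let n ≥ 1, and let f ∈ 𝔽_p[x₁,…,x_n] be a homogeneous polynomial of degree at most p−1. Let Z = {x ∈ 𝔽_p^n : f(x) = 0}, let a ∈ 𝔽_p ∖ {0}, and let S = {x ∈ 𝔽_p^n : f(x) = a}. Then there is no pair (x,d) with x ∈ Z, d ∈ Z, and x + λd ∈ S for every λ ∈ {1, 2, …, p−1} ⊆ 𝔽_p; that is, the p-fold combinatorial rectangle Z × S × ⋯ × S contains no line with direction in Z. -/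
open Polynomial in
/-- The coefficient of a product of polynomials at the sum of degree bounds is the product of the
coefficients at those bounds. -/
lemma Polynomial.natDegree_prod_le_and_coeff_prod_sum {ι R : Type*} [CommSemiring R]
    (s : Finset ι) (g : ι → R[X]) (m : ι → ℕ) (h : ∀ i ∈ s, (g i).natDegree ≤ m i) :
    (∏ i ∈ s, g i).natDegree ≤ ∑ i ∈ s, m i ∧
      (∏ i ∈ s, g i).coeff (∑ i ∈ s, m i) = ∏ i ∈ s, (g i).coeff (m i) := by
  classical
  induction s using Finset.induction_on with
  | empty => simp
  | insert i s hi ih =>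
    obtain ⟨hdeg, hcoeff⟩ := ih fun j hj => h j (Finset.mem_insert_of_mem hj)
    have hgi := h i (Finset.mem_insert_self i s)
    rw [Finset.prod_insert hi, Finset.sum_insert hi, Finset.prod_insert hi]
    exact ⟨natDegree_mul_le_of_le hgi hdeg,
      by rw [coeff_mul_add_eq_of_natDegree_le hgi hdeg, hcoeff]⟩

namespace MvPolynomial

variable {σ R : Type*} [CommSemiring R]

/-- The restriction of `f` to the line `t ↦ x + t • v`, as a univariate polynomial. -/
noncomputable def restrictLine (f : MvPolynomial σ R) (x v : σ → R) : Polynomial R :=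
  aeval (fun i => Polynomial.C (v i) * Polynomial.X + Polynomial.C (x i)) f

lemma eval_restrictLine (f : MvPolynomial σ R) (x v : σ → R) (t : R) :
    (f.restrictLine x v).eval t = eval (x + t • v) f := by
  rw [restrictLine, aeval_def, ← Polynomial.coe_evalRingHom, hom_eval₂, eval, coe_eval₂Hom]
  congr 1
  · ext; simp
  · ext i
    simp [mul_comm (v i), add_comm (x i)]

/-- A homogeneous polynomial of degree `d` restricts to a line with direction `v` as a polynomial
of degree at most `d`, whose coefficient at `d` is the value at `v`. -/
lemma IsHomogeneous.natDegree_restrictLine_le_and_coeff {f : MvPolynomial σ R} {d : ℕ}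
    (hf : f.IsHomogeneous d) (x v : σ → R) :
    (f.restrictLine x v).natDegree ≤ d ∧ (f.restrictLine x v).coeff d = eval v f := by
  have key : ∀ m ∈ f.support,
      (∏ i ∈ m.support, (Polynomial.C (v i) * Polynomial.X + Polynomial.C (x i)) ^ m i).natDegree
          ≤ d ∧
        (∏ i ∈ m.support,
          (Polynomial.C (v i) * Polynomial.X + Polynomial.C (x i)) ^ m i).coeff d =
            ∏ i ∈ m.support, v i ^ m i := by
    intro m hm
    have hlin i : (Polynomial.C (v i) * Polynomial.X + Polynomial.C (x i)).natDegree ≤ 1 :=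
      Polynomial.natDegree_linear_le
    have hmd : ∑ i ∈ m.support, m i = d := by
      simp [← hf (mem_support_iff.1 hm), Finsupp.weight_apply, Finsupp.sum]
    obtain ⟨hdeg, hcoeff⟩ := Polynomial.natDegree_prod_le_and_coeff_prod_sum m.support
      (fun i => (Polynomial.C (v i) * Polynomial.X + Polynomial.C (x i)) ^ m i) m
      fun i _ => by simpa using Polynomial.natDegree_pow_le_of_le (m i) (hlin i)
    rw [hmd] at hdeg hcoeff
    refine ⟨hdeg, hcoeff.trans (Finset.prod_congr rfl fun i _ => ?_)⟩
    simpa using Polynomial.coeff_pow_of_natDegree_le (m := m i) (hlin i)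
  rw [restrictLine, aeval_def, eval₂_eq, eval_eq, Polynomial.finsetSum_coeff]
  refine ⟨Polynomial.natDegree_sum_le_of_forall_le _ _ fun m hm =>
    (Polynomial.natDegree_C_mul_le _ _).trans (key m hm).1, Finset.sum_congr rfl fun m hm => ?_⟩
  rw [← (key m hm).2]
  exact Polynomial.coeff_C_mul _

end MvPolynomial

/-- let `p` be a prime, `n ≥ 1`, and `f ∈ 𝔽_p[x₁,…,x_n]` homogeneous of
degree at most `p−1`. Let `Z = Z(f)`, `a ≠ 0` and `S = {x : f(x) = a}`. Then there is no
pair `(x,d)` with `x ∈ Z`, `d ∈ Z` and `x + λd ∈ S` for every `λ ∈ {1,…,p−1}`; i.e. the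
rectangle `Z × S × ⋯ × S` contains no line with direction in `Z`. -/
theorem stmt9 (p n : ℕ) (hp : p.Prime) (hn : 1 ≤ n)
    (f : MvPolynomial (Fin n) (ZMod p)) (d : ℕ) (hd : d ≤ p - 1)
    (hf : f.IsHomogeneous d) (a : ZMod p) (ha : a ≠ 0) :
    ¬ ∃ x dir : Fin n → ZMod p,
        MvPolynomial.eval x f = 0 ∧ MvPolynomial.eval dir f = 0 ∧
        ∀ lam : ZMod p, lam ≠ 0 → MvPolynomial.eval (x + lam • dir) f = a := by
  have : Fact p.Prime := ⟨hp⟩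
  rintro ⟨x, dir, hx, hdir, hline⟩
  obtain ⟨hdeg, hcoeff⟩ := hf.natDegree_restrictLine_le_and_coeff x dir
  have hlt : (f.restrictLine x dir).degree < d :=
    (Polynomial.degree_lt_iff_coeff_zero _ _).2 fun m hm => by
      rcases hm.eq_or_lt with rfl | hm
      · rw [hcoeff, hdir]
      · exact Polynomial.coeff_eq_zero_of_natDegree_lt (hdeg.trans_lt hm)
  have hcard : (Finset.univ.erase (0 : ZMod p)).card = p - 1 := by
    rw [Finset.card_erase_of_mem (Finset.mem_univ _), Finset.card_univ, ZMod.card]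
  have hconst : f.restrictLine x dir = Polynomial.C a := by
    refine Polynomial.eq_of_degrees_lt_of_eval_finset_eq (Finset.univ.erase (0 : ZMod p)) ?_ ?_ ?_
    · rw [hcard]
      exact hlt.trans_le (by exact_mod_cast hd)
    · rw [hcard]
      exact Polynomial.degree_C_le.trans_lt (by exact_mod_cast Nat.sub_pos_of_lt hp.one_lt)
    · intro t ht
      rw [MvPolynomial.eval_restrictLine, hline t (Finset.ne_of_mem_erase ht), Polynomial.eval_C]
  have hzero := MvPolynomial.eval_restrictLine f x dir 0
  rw [hconst, Polynomial.eval_C, zero_smul, add_zero, hx] at hzero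
  exact ha hzero
end

section
/- Let F be a finite field with q elements and let f₁,…,f_k ∈ F[x₁,…,x_n] be nonzero polynomials whose total degrees satisfy d = deg(f₁) + ⋯ + deg(f_k) < n. If the system f₁(x) = f₂(x) = ⋯ = f_k(x) = 0 has at least one solution x ∈ F^n, then it has at least q^{n−d} solutions in F^n. -/
/-- Exchanging base and exponent: `(1 + N) ^ j ≤ (1 + j) ^ N` for `j ≤ N`. -/
theorem one_add_pow_le_one_add_pow_swap {j N : ℕ} (h : j ≤ N) :
    (1 + N) ^ j ≤ (1 + j) ^ N := by
  rcases Nat.eq_zero_or_pos j with rfl | hj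
  · simp
  have hj' : (0 : ℝ) < j := by exact_mod_cast hj
  have hp : (1 : ℝ) ≤ (N : ℝ) / j := by
    rw [le_div_iff₀ hj']
    exact_mod_cast (by simpa using h)
  have hb := one_add_mul_self_le_rpow_one_add (s := (j : ℝ)) (by linarith) hp
  rw [div_mul_cancel₀ _ hj'.ne'] at hb
  have hpow := pow_le_pow_left₀ (by positivity) hb j
  rw [← Real.rpow_mul_natCast (by positivity), div_mul_cancel₀ _ hj'.ne',
    Real.rpow_natCast] at hpow
  exact_mod_cast hpow

namespace MvPolynomial

/-- The exponent in `{0, …, q - 1}` defining the same power function as `a` on a field with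
`q` elements. -/
def reducedExponent (q a : ℕ) : ℕ := if a = 0 then 0 else (a - 1) % (q - 1) + 1

theorem reducedExponent_le (q a : ℕ) : reducedExponent q a ≤ a := by
  unfold reducedExponent
  split_ifs with h
  · omega
  · have := Nat.mod_le (a - 1) (q - 1)
    omega

theorem reducedExponent_lt {q : ℕ} (hq : 1 < q) (a : ℕ) : reducedExponent q a < q := by
  unfold reducedExponent
  split_ifs with h
  · omega
  · have := Nat.mod_lt (a - 1) (show q - 1 > 0 by omega)
    omega

theorem totalDegree_prod_one_sub_pow_le {R : Type*} [CommRing R] {n k : ℕ}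
    (f : Fin k → MvPolynomial (Fin n) R) (e : ℕ) :
    (∏ i, (1 - f i ^ e)).totalDegree ≤ e * ∑ i, (f i).totalDegree := by
  rw [Finset.mul_sum]
  refine (totalDegree_finsetProd _ _).trans (Finset.sum_le_sum fun i _ => ?_)
  refine (totalDegree_sub _ _).trans ?_
  simpa using totalDegree_pow (f i) e

variable {F : Type*} [Field F] [Fintype F]

theorem pow_reducedExponent (x : F) (a : ℕ) :
    x ^ reducedExponent (Fintype.card F) a = x ^ a := by
  unfold reducedExponent
  split_ifs with h
  · simp [h]
  rcases eq_or_ne x 0 with rfl | hx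
  · simp [h]
  have hdecomp : a = (Fintype.card F - 1) * ((a - 1) / (Fintype.card F - 1))
      + ((a - 1) % (Fintype.card F - 1) + 1) := by
    have := Nat.div_add_mod (a - 1) (Fintype.card F - 1)
    omega
  conv_rhs => rw [hdecomp, pow_add, pow_mul, FiniteField.pow_card_sub_one_eq_one x hx, one_pow,
    one_mul]

/-- Every polynomial over a finite field with `q` elements defines the same function as one of no
larger total degree all of whose individual degrees are less than `q`. -/
theorem exists_degreeOf_lt_card_eval_eq {n : ℕ} (p : MvPolynomial (Fin n) F) :
    ∃ r : MvPolynomial (Fin n) F, (∀ i, r.degreeOf i < Fintype.card F) ∧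
      r.totalDegree ≤ p.totalDegree ∧ ∀ x, eval x r = eval x p := by
  classical
  let red : (Fin n →₀ ℕ) → (Fin n →₀ ℕ) := fun e =>
    Finsupp.equivFunOnFinite.symm fun i => reducedExponent (Fintype.card F) (e i)
  refine ⟨∑ e ∈ p.support, monomial (red e) (coeff e p), fun i => ?_, ?_, fun x => ?_⟩
  · refine (degreeOf_sum_le _ _ _).trans_lt ?_
    rw [Finset.sup_lt_iff Fintype.card_pos]
    intro e he
    rw [degreeOf_monomial_eq _ _ (mem_support_iff.1 he)]
    exact reducedExponent_lt Fintype.one_lt_card _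
  · refine totalDegree_finsetSum_le fun e he => ?_
    refine le_trans ?_ (le_totalDegree he)
    rw [totalDegree_monomial _ (mem_support_iff.1 he), Finsupp.sum_fintype _ _ (by simp),
      Finsupp.sum_fintype _ _ (by simp)]
    exact Finset.sum_le_sum fun i _ => reducedExponent_le _ _
  · rw [map_sum, eval_eq']
    refine Finset.sum_congr rfl fun e _ => ?_
    rw [eval_monomial, Finsupp.prod_fintype _ _ (by simp)]
    congr 1
    exact Finset.prod_congr rfl fun i _ => pow_reducedExponent _ _

open Classical in
/-- The number of points of `F ^ (n + 1)` at which `p` does not vanish, compared with the number of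
points of `F ^ n` at which the leading coefficient of `p` in its first variable does not vanish. -/
theorem card_eval_leadingCoeff_ne_zero_mul_le {n : ℕ} (p : MvPolynomial (Fin (n + 1)) F) :
    (Finset.univ.filter fun s : Fin n → F =>
        eval s (finSuccEquiv F n p).leadingCoeff ≠ 0).card *
      (Fintype.card F - p.degreeOf 0) ≤
    (Finset.univ.filter fun x : Fin (n + 1) → F => eval x p ≠ 0).card := by
  set B := Finset.univ.filter fun s : Fin n → F =>
    eval s (finSuccEquiv F n p).leadingCoeff ≠ 0 with hB
  let fiber : (Fin n → F) → Finset F := fun s => Finset.univ.filter fun y =>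
    eval (Fin.cons y s : Fin (n + 1) → F) p ≠ 0
  have hfiber : ∀ s ∈ B, Fintype.card F - p.degreeOf 0 ≤ (fiber s).card := by
    intro s hs
    set g := (finSuccEquiv F n p).map (eval s) with hg
    have hg0 : g ≠ 0 := by
      intro h
      apply (Finset.mem_filter.1 hs).2
      have hcoeff := congrArg (Polynomial.coeff · (finSuccEquiv F n p).natDegree) h
      rwa [hg, Polynomial.coeff_map, Polynomial.coeff_zero] at hcoeff
    have hcompl : (fiber s)ᶜ ⊆ g.roots.toFinset := by
      intro y hy
      rw [Multiset.mem_toFinset, Polynomial.mem_roots hg0, Polynomial.IsRoot, hg,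
        ← eval_eq_eval_mv_eval']
      simpa [fiber] using hy
    have hcard := (Finset.card_le_card hcompl).trans
      ((Multiset.toFinset_card_le _).trans ((Polynomial.card_roots' g).trans
        Polynomial.natDegree_map_le))
    rw [natDegree_finSuccEquiv, Finset.card_compl] at hcard
    omega
  calc B.card * (Fintype.card F - p.degreeOf 0)
      ≤ ∑ s ∈ B, (fiber s).card := Finset.card_nsmul_le_sum _ _ _ hfiber
    _ = (B.sigma fiber).card := (Finset.card_sigma _ _).symm
    _ ≤ _ := by
      refine Finset.card_le_card_of_injOn (fun z => Fin.cons z.2 z.1) ?_ ?_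
      · intro z hz
        simpa [fiber] using (Finset.mem_filter.1 (Finset.mem_sigma.1 hz).2).2
      · rintro ⟨s, y⟩ - ⟨t, z⟩ - h
        obtain ⟨rfl, rfl⟩ := Fin.cons_injective2 h
        rfl

open Classical in
/-- A nonzero polynomial in `n` variables of total degree `D`, all of whose individual degrees are
less than `q = |F|`, has at least `q ^ (n - D / (q - 1))` nonvanishing points. -/
theorem card_pow_le_card_eval_ne_zero_pow_mul {n : ℕ} (p : MvPolynomial (Fin n) F) (hp : p ≠ 0)
    (hdeg : ∀ i, p.degreeOf i < Fintype.card F) :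
    Fintype.card F ^ ((Fintype.card F - 1) * n) ≤
      (Finset.univ.filter fun x : Fin n → F => eval x p ≠ 0).card ^ (Fintype.card F - 1) *
        Fintype.card F ^ p.totalDegree := by
  induction n with
  | zero =>
    rw [eq_C_of_isEmpty p] at hp ⊢
    have hc : coeff 0 p ≠ 0 := fun h => hp (by simp [h])
    simp [hc]
  | succ n ih =>
    set q := Fintype.card F with hq
    have hq1 : 1 < q := Fintype.one_lt_card
    set g := (finSuccEquiv F n p).leadingCoeff with hg
    set m := p.degreeOf 0 with hm
    have hmq : m < q := hdeg 0
    have hg0 : g ≠ 0 := by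
      rw [hg, Polynomial.leadingCoeff_ne_zero]
      exact (map_ne_zero_iff _ (finSuccEquiv F n).injective).2 hp
    have hgm : g = (finSuccEquiv F n p).coeff m := by
      rw [hg, Polynomial.leadingCoeff, natDegree_finSuccEquiv]
    have hgdeg : ∀ i, g.degreeOf i < q := fun i =>
      (hgm ▸ degreeOf_coeff_finSuccEquiv p i m).trans_lt (hdeg i.succ)
    have htot : g.totalDegree + m ≤ p.totalDegree := by
      rw [hgm] at hg0 ⊢
      exact totalDegree_coeff_finSuccEquiv_add_le p m hg0
    have hih := ih g hg0 hgdeg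
    have hswap : q ^ (q - 1) ≤ (q - m) ^ (q - 1) * q ^ m := by
      have h := one_add_pow_le_one_add_pow_swap (j := q - 1 - m) (N := q - 1) (by omega)
      rw [show 1 + (q - 1) = q by omega, show 1 + (q - 1 - m) = q - m by omega] at h
      calc q ^ (q - 1) = q ^ (q - 1 - m) * q ^ m := by rw [← pow_add]; congr 1; omega
        _ ≤ _ := Nat.mul_le_mul_right _ h
    have hcount := card_eval_leadingCoeff_ne_zero_mul_le p
    rw [← hg, ← hm, ← hq] at hcount
    calc q ^ ((q - 1) * (n + 1)) = q ^ ((q - 1) * n) * q ^ (q - 1) := by rw [← pow_add]; rfl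
      _ ≤ _ := Nat.mul_le_mul hih hswap
      _ = ((Finset.univ.filter fun s : Fin n → F => eval s g ≠ 0).card * (q - m)) ^ (q - 1) *
            q ^ (g.totalDegree + m) := by rw [mul_pow, pow_add]; ring
      _ ≤ _ := Nat.mul_le_mul (Nat.pow_le_pow_left hcount _)
        (Nat.pow_le_pow_right (by omega) htot)

/-- The polynomial `∏ i, (1 - f i ^ (q - 1))` does not vanish exactly at the common zeros of the
`f i`. -/
theorem eval_prod_one_sub_pow_ne_zero_iff {n k : ℕ} (f : Fin k → MvPolynomial (Fin n) F)
    (x : Fin n → F) :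
    eval x (∏ i, (1 - f i ^ (Fintype.card F - 1))) ≠ 0 ↔ ∀ i, eval x (f i) = 0 := by
  have hq1 : 1 < Fintype.card F := Fintype.one_lt_card
  simp only [map_prod, map_sub, map_one, map_pow, Finset.prod_ne_zero_iff, Finset.mem_univ,
    true_implies]
  refine forall_congr' fun i => ⟨fun h => ?_, fun h => ?_⟩
  · by_contra h0
    exact h (by rw [FiniteField.pow_card_sub_one_eq_one _ h0, sub_self])
  · rw [h, zero_pow (by omega)]
    simp

end MvPolynomial

/-- Chevalley–Warning solution count: for a finite field `F` with `q`
elements and nonzero polynomials `f₁,…,f_k ∈ F[x₁,…,x_n]` with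
`d = deg(f₁) + ⋯ + deg(f_k) < n`, if the system `f₁(x) = ⋯ = f_k(x) = 0` has a solution
in `Fⁿ`, then it has at least `q^{n−d}` solutions. -/
theorem stmt12 (F : Type) [Field F] [Fintype F] (n k : ℕ)
    (f : Fin k → MvPolynomial (Fin n) F) (hf : ∀ i, f i ≠ 0)
    (hd : ∑ i, (f i).totalDegree < n)
    (hsol : ∃ x : Fin n → F, ∀ i, MvPolynomial.eval x (f i) = 0) :
    Fintype.card F ^ (n - ∑ i, (f i).totalDegree) ≤
      Set.ncard {x : Fin n → F | ∀ i, MvPolynomial.eval x (f i) = 0} := by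
  classical
  obtain ⟨x₀, hx₀⟩ := hsol
  set q := Fintype.card F with hq
  set d := ∑ i, (f i).totalDegree with hd_def
  have hq1 : 1 < q := Fintype.one_lt_card
  obtain ⟨r, hrdeg, hrtot, hreval⟩ :=
    MvPolynomial.exists_degreeOf_lt_card_eval_eq (∏ i, (1 - f i ^ (q - 1)))
  have hiff : ∀ x, MvPolynomial.eval x r ≠ 0 ↔ ∀ i, MvPolynomial.eval x (f i) = 0 := fun x => by
    rw [hreval]
    exact MvPolynomial.eval_prod_one_sub_pow_ne_zero_iff f x
  have hr0 : r ≠ 0 := by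
    rintro rfl
    exact (hiff x₀).2 hx₀ (map_zero _)
  have hset : {x : Fin n → F | ∀ i, MvPolynomial.eval x (f i) = 0} =
      ↑(Finset.univ.filter fun x : Fin n → F => MvPolynomial.eval x r ≠ 0) := by
    ext x
    simp [← hiff]
  rw [hset, Set.ncard_coe_finset]
  have hbound := (MvPolynomial.card_pow_le_card_eval_ne_zero_pow_mul r hr0 hrdeg).trans
    (Nat.mul_le_mul_left _ (Nat.pow_le_pow_right (by omega)
      (hrtot.trans (MvPolynomial.totalDegree_prod_one_sub_pow_le f (q - 1)))))
  rw [← hq, ← hd_def] at hbound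
  rw [← Nat.pow_le_pow_iff_left (n := q - 1) (by omega)]
  refine Nat.le_of_mul_le_mul_right (le_trans (le_of_eq ?_) hbound)
    (Nat.pow_pos (n := (q - 1) * d) (by omega : 0 < q))
  rw [← pow_mul, ← pow_add, mul_comm _ (q - 1), ← Nat.mul_add, Nat.sub_add_cancel hd.le]
end
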